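/- arXiv:2308.09726 — 9 statements merged into one kernel-verified Lean document; each statement's English description precedes it below -/
import Mathlib

section
/- Weak duality for the Lagrangian relaxation of an RMAB: for every joint state s and every budget b : ℕ, the Lagrangian bound upper-bounds the value function, i.e., V 0 s b ≤ L s (b : ℝ). -/
open Finset

noncomputable def Vval (N : ℕ) {S : Type} [Fintype S]
    (P : Fin N → S → Bool → S → ℝ) (R : S → ℝ) (H : ℕ)
    (t : ℕ) (s : Fin N → S) (b : ℕ) : ℝ :=
  if _h : t < H then
    (Finset.univ.filter (fun a : Fin N → Bool =>
        (Finset.univ.filter (fun n => a n = true)).card ≤ b)).sup'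
      ⟨fun _ => false, by simp⟩
      (fun a => (∑ n : Fin N, R (s n)) +
        ∑ s' : Fin N → S, (∏ n : Fin N, P n (s n) (a n) (s' n)) * Vval N P R H (t+1) s' b)
  else 0
termination_by H - t
decreasing_by omega

noncomputable def vCharged (N : ℕ) {S : Type} [Fintype S]
    (P : Fin N → S → Bool → S → ℝ) (R : S → ℝ) (H : ℕ)
    (n : Fin N) (lam : Fin H → ℝ) (t : ℕ) (x : S) : ℝ :=
  if h : t < H then
    max (R x + ∑ s' : S, P n x false s' * vCharged N P R H n lam (t+1) s')
        ((R x - lam ⟨t, h⟩) + ∑ s' : S, P n x true s' * vCharged N P R H n lam (t+1) s')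
  else 0
termination_by H - t
decreasing_by all_goals omega

noncomputable def Lag (N : ℕ) {S : Type} [Fintype S]
    (P : Fin N → S → Bool → S → ℝ) (R : S → ℝ) (H : ℕ)
    (s : Fin N → S) (β : ℝ) : ℝ :=
  sInf {z : ℝ | ∃ lam : Fin H → ℝ, (∀ k, 0 ≤ lam k) ∧
    z = (∑ n : Fin N, vCharged N P R H n lam 0 (s n)) + β * ∑ k : Fin H, lam k}

theorem wd_prod_one {N : ℕ} {S : Type} [Fintype S] (p : Fin N → S → ℝ)
    (h1 : ∀ n, ∑ x, p n x = 1) : ∑ s' : Fin N → S, ∏ n, p n (s' n) = 1 := by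
  classical
  rw [← Fintype.prod_sum]
  simp [h1]

theorem wd_marginal {N : ℕ} {S : Type} [Fintype S] (p : Fin N → S → ℝ)
    (h1 : ∀ n, ∑ x, p n x = 1) (m : Fin N) (f : S → ℝ) :
    ∑ s' : Fin N → S, (∏ n, p n (s' n)) * f (s' m) = ∑ x, p m x * f x := by
  classical
  have h := Fintype.prod_sum (fun n x => p n x * (if n = m then f x else 1))
  have e : ∀ s' : Fin N → S, (∏ n, p n (s' n) * (if n = m then f (s' n) else 1))
      = (∏ n, p n (s' n)) * f (s' m) := by
    intro s'
    rw [Finset.prod_mul_distrib]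
    simp
  simp only [e] at h
  rw [← h, Finset.prod_eq_single m]
  · simp
  · intro n _ hn
    simp [hn, h1]
  · simp

theorem wd_tail {H : ℕ} (lam : Fin H → ℝ) (t : ℕ) (h : t < H) :
    (∑ k : Fin H, if t ≤ k.val then lam k else 0)
      = lam ⟨t, h⟩ + ∑ k : Fin H, if t + 1 ≤ k.val then lam k else 0 := by
  have e : lam ⟨t, h⟩ = ∑ k : Fin H, if k = ⟨t, h⟩ then lam k else 0 := by simp
  rw [e, ← Finset.sum_add_distrib]
  refine Finset.sum_congr rfl fun k _ => ?_
  by_cases hk : k = ⟨t, h⟩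
  · subst hk
    simp
  · have : k.val ≠ t := fun h' => hk (Fin.ext h')
    have e2 : (t ≤ k.val) ↔ (t + 1 ≤ k.val) := by omega
    simp [hk, e2]

theorem wd_main (N : ℕ) (S : Type) [Fintype S]
    (P : Fin N → S → Bool → S → ℝ)
    (hP0 : ∀ (n : Fin N) (x : S) (a : Bool) (x' : S), 0 ≤ P n x a x')
    (hP1 : ∀ (n : Fin N) (x : S) (a : Bool), ∑ x' : S, P n x a x' = 1)
    (R : S → ℝ) (H : ℕ) (b : ℕ) (lam : Fin H → ℝ) (hl : ∀ k, 0 ≤ lam k) (d : ℕ) :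
    ∀ (t : ℕ) (_ : H - t = d) (s : Fin N → S), Vval N P R H t s b ≤
      (∑ n, vCharged N P R H n lam t (s n))
        + b * ∑ k : Fin H, if t ≤ k.val then lam k else 0 := by
  induction d with
  | zero =>
    intro t ht s
    have hn : ¬ t < H := by omega
    have h2 : ∀ n x, vCharged N P R H n lam t x = 0 := by
      intro n x
      rw [vCharged]
      simp [hn]
    rw [Vval]
    simp only [hn, dite_false, h2, Finset.sum_const_zero, zero_add]
    refine mul_nonneg (Nat.cast_nonneg _) (Finset.sum_nonneg fun k _ => ?_)
    split_ifs
    · exact hl k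
    · exact le_rfl
  | succ d ih =>
    intro t ht s
    have hn : t < H := by omega
    have ih' := ih (t + 1) (by omega)
    rw [Vval]
    simp only [hn, dite_true]
    refine Finset.sup'_le _ _ fun a ha => ?_
    have hcard : (Finset.univ.filter (fun n => a n = true)).card ≤ b := by simpa using ha
    set T := ∑ k : Fin H, if t + 1 ≤ k.val then lam k else 0 with hT
    rw [wd_tail lam t hn, ← hT]
    have step1 : ∑ s' : Fin N → S, (∏ n, P n (s n) (a n) (s' n)) * Vval N P R H (t+1) s' b
        ≤ (∑ n, ∑ x, P n (s n) (a n) x * vCharged N P R H n lam (t+1) x) + b * T := by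
      calc _ ≤ ∑ s' : Fin N → S, (∏ n, P n (s n) (a n) (s' n)) *
            ((∑ n, vCharged N P R H n lam (t+1) (s' n)) + b * T) := by
            refine Finset.sum_le_sum fun s' _ => ?_
            exact mul_le_mul_of_nonneg_left (ih' s')
              (Finset.prod_nonneg fun n _ => hP0 _ _ _ _)
        _ = _ := by
            simp only [mul_add, Finset.sum_add_distrib, Finset.mul_sum]
            rw [Finset.sum_comm]
            congr 1
            · refine Finset.sum_congr rfl fun m _ => ?_
              exact wd_marginal (fun n x => P n (s n) (a n) x) (fun n => hP1 _ _ _) m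
                (fun x => vCharged N P R H m lam (t+1) x)
            · skip
              rw [← Finset.sum_mul,
                wd_prod_one (fun n x => P n (s n) (a n) x) (fun n => hP1 _ _ _), one_mul]
    have step2 : ∀ n, R (s n) + ∑ x, P n (s n) (a n) x * vCharged N P R H n lam (t+1) x
        ≤ vCharged N P R H n lam t (s n) + if a n = true then lam ⟨t, hn⟩ else 0 := by
      intro n
      rw [vCharged.eq_def N P R H n lam t]
      simp only [hn, dite_true]
      cases hb : a n
      · simp
      · simp only [if_true]
        rw [← sub_le_iff_le_add]
        refine le_trans (le_of_eq ?_) (le_max_right _ _)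
        ring
    have step3 := Finset.sum_le_sum (fun n (_ : n ∈ Finset.univ) => step2 n)
    rw [Finset.sum_add_distrib, Finset.sum_add_distrib, ← Finset.sum_filter,
      Finset.sum_const, nsmul_eq_mul] at step3
    have step4 : ((Finset.univ.filter (fun n => a n = true)).card : ℝ) * lam ⟨t, hn⟩
        ≤ b * lam ⟨t, hn⟩ :=
      mul_le_mul_of_nonneg_right (by exact_mod_cast hcard) (hl _)
    rw [mul_add]
    linarith

theorem weak_duality
    (N : ℕ) (S : Type) [Fintype S] [Nonempty S]
    (P : Fin N → S → Bool → S → ℝ)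
    (hP0 : ∀ (n : Fin N) (x : S) (a : Bool) (x' : S), 0 ≤ P n x a x')
    (hP1 : ∀ (n : Fin N) (x : S) (a : Bool), ∑ x' : S, P n x a x' = 1)
    (R : S → ℝ) (H : ℕ)
    (s : Fin N → S) (b : ℕ) :
    Vval N P R H 0 s b ≤ Lag N P R H s (b : ℝ) := by
  refine le_csInf ⟨_, fun _ => 0, fun _ => le_rfl, rfl⟩ ?_
  rintro z ⟨lam, hl, rfl⟩
  simpa using wd_main N S P hP0 hP1 R H b lam hl H 0 (by simp) s
end

section
/- The Lagrangian bound is tight at zero budget: for every joint state s, L s 0 = V 0 s 0. (Established in the proof of Theorem 3.) -/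
open Finset

noncomputable def wPass (N : ℕ) {S : Type} [Fintype S]
    (P : Fin N → S → Bool → S → ℝ) (R : S → ℝ) (H : ℕ)
    (n : Fin N) (t : ℕ) (x : S) : ℝ :=
  if t < H then R x + ∑ s' : S, P n x false s' * wPass N P R H n (t+1) s'
  else 0
termination_by H - t
decreasing_by omega

theorem marginal_aux {N : ℕ} {S : Type} [Fintype S] (p : Fin N → S → ℝ)
    (hp : ∀ m, ∑ x, p m x = 1) (n : Fin N) (f : S → ℝ) :
    ∑ s' : Fin N → S, (∏ m, p m (s' m)) * f (s' n) = ∑ x, p n x * f x := by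
  classical
  have h1 : ∀ s' : Fin N → S, (∏ m, p m (s' m)) * f (s' n)
      = ∏ m, (p m (s' m) * if m = n then f (s' m) else 1) := by
    intro s'
    rw [Finset.prod_mul_distrib]
    simp
  simp_rw [h1]
  have h2 := Finset.prod_univ_sum (fun _ : Fin N => (Finset.univ : Finset S))
    (fun m x => p m x * if m = n then f x else 1)
  rw [Fintype.piFinset_univ] at h2
  rw [← h2, Finset.prod_eq_single n]
  · simp
  · intro m _ hm
    simp [hm, hp]
  · simp

theorem wPass_le {N : ℕ} {S : Type} [Fintype S]
    (P : Fin N → S → Bool → S → ℝ)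
    (hP0 : ∀ (n : Fin N) (x : S) (a : Bool) (x' : S), 0 ≤ P n x a x')
    (R : S → ℝ) (H : ℕ) (n : Fin N) (lam : Fin H → ℝ) (k : ℕ) :
    ∀ (t : ℕ) (x : S), H - t = k → wPass N P R H n t x ≤ vCharged N P R H n lam t x := by
  induction k with
  | zero =>
    intro t x h
    rw [wPass, vCharged, if_neg (by omega), dif_neg (by omega)]
  | succ k ih =>
    intro t x h
    rw [wPass, vCharged, if_pos (by omega), dif_pos (by omega)]
    apply le_max_of_le_left
    gcongr with y
    · exact hP0 _ _ _ _
    · exact ih _ _ (by omega)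

noncomputable def bigLam (N : ℕ) {S : Type} [Fintype S]
    (P : Fin N → S → Bool → S → ℝ) (R : S → ℝ) (H : ℕ) (k : Fin H) : ℝ :=
  ∑ n : Fin N, ∑ x : S, |(∑ s' : S, P n x true s' * wPass N P R H n (k+1) s')
    - ∑ s' : S, P n x false s' * wPass N P R H n (k+1) s'|

theorem vCharged_bigLam {N : ℕ} {S : Type} [Fintype S]
    (P : Fin N → S → Bool → S → ℝ)
    (R : S → ℝ) (H : ℕ) (n : Fin N) (k : ℕ) :
    ∀ (t : ℕ) (x : S), H - t = k →
      vCharged N P R H n (bigLam N P R H) t x = wPass N P R H n t x := by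
  induction k with
  | zero =>
    intro t x h
    rw [wPass, vCharged, if_neg (by omega), dif_neg (by omega)]
  | succ k ih =>
    intro t x h
    have ht : t < H := by omega
    rw [wPass, vCharged, if_pos ht, dif_pos ht]
    have e : ∀ y, vCharged N P R H n (bigLam N P R H) (t+1) y = wPass N P R H n (t+1) y :=
      fun y => ih _ _ (by omega)
    simp_rw [e]
    apply max_eq_left
    have h1 : |(∑ s' : S, P n x true s' * wPass N P R H n (t+1) s')
        - ∑ s' : S, P n x false s' * wPass N P R H n (t+1) s'| ≤ bigLam N P R H ⟨t, ht⟩ := by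
      unfold bigLam
      refine le_trans ?_ (Finset.single_le_sum (f := fun n => ∑ x : S,
        |(∑ s' : S, P n x true s' * wPass N P R H n (t+1) s')
        - ∑ s' : S, P n x false s' * wPass N P R H n (t+1) s'|)
        (fun m _ => Finset.sum_nonneg fun _ _ => abs_nonneg _) (Finset.mem_univ n))
      exact Finset.single_le_sum (f := fun x =>
        |(∑ s' : S, P n x true s' * wPass N P R H n (t+1) s')
        - ∑ s' : S, P n x false s' * wPass N P R H n (t+1) s'|)
        (fun _ _ => abs_nonneg _) (Finset.mem_univ x)
    have h2 := le_trans (le_abs_self _) h1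
    linarith

theorem Vval_zero {N : ℕ} {S : Type} [Fintype S]
    (P : Fin N → S → Bool → S → ℝ)
    (hP1 : ∀ (n : Fin N) (x : S) (a : Bool), ∑ x' : S, P n x a x' = 1)
    (R : S → ℝ) (H : ℕ) (k : ℕ) :
    ∀ (t : ℕ) (s : Fin N → S), H - t = k →
      Vval N P R H t s 0 = ∑ n, wPass N P R H n t (s n) := by
  induction k with
  | zero =>
    intro t s h
    rw [Vval, dif_neg (by omega)]
    symm
    apply Finset.sum_eq_zero
    intro n _
    rw [wPass, if_neg (by omega)]
  | succ k ih =>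
    intro t s h
    have ht : t < H := by omega
    have e : ∀ y, Vval N P R H (t+1) y 0 = ∑ n, wPass N P R H n (t+1) (y n) :=
      fun y => ih _ _ (by omega)
    have key : (∑ n : Fin N, R (s n)) + ∑ s' : Fin N → S,
        (∏ n : Fin N, P n (s n) false (s' n)) * Vval N P R H (t+1) s' 0
        = ∑ n, wPass N P R H n t (s n) := by
      have e2 : ∀ n, wPass N P R H n t (s n) = R (s n) +
          ∑ s' : S, P n (s n) false s' * wPass N P R H n (t+1) s' := by
        intro n
        rw [wPass, if_pos ht]
      simp_rw [e, e2, Finset.sum_add_distrib, Finset.mul_sum]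
      congr 1
      rw [Finset.sum_comm]
      apply Finset.sum_congr rfl
      intro n _
      exact marginal_aux (fun m x => P m (s m) false x) (fun m => hP1 _ _ _) n _
    rw [← key, Vval, dif_pos ht]
    apply le_antisymm
    · apply Finset.sup'_le
      intro a ha
      have ha' : ∀ n, a n = false := by
        intro n
        simp [Finset.filter_eq_empty_iff] at ha
        exact @ha n
      simp [ha']
    · exact Finset.le_sup' (fun a : Fin N → Bool => (∑ n : Fin N, R (s n)) +
        ∑ s' : Fin N → S, (∏ n : Fin N, P n (s n) (a n) (s' n)) * Vval N P R H (t+1) s' 0)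
        (b := fun _ => false) (by simp)

theorem L_tight_at_zero_budget
    (N : ℕ) (S : Type) [Fintype S] [Nonempty S]
    (P : Fin N → S → Bool → S → ℝ)
    (hP0 : ∀ (n : Fin N) (x : S) (a : Bool) (x' : S), 0 ≤ P n x a x')
    (hP1 : ∀ (n : Fin N) (x : S) (a : Bool), ∑ x' : S, P n x a x' = 1)
    (R : S → ℝ) (H : ℕ)
    (s : Fin N → S) :
    Lag N P R H s 0 = Vval N P R H 0 s 0 := by
  rw [Vval_zero P hP1 R H _ 0 s rfl]
  unfold Lag
  apply IsLeast.csInf_eq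
  constructor
  · refine ⟨bigLam N P R H, ?_, ?_⟩
    · intro k
      exact Finset.sum_nonneg fun _ _ => Finset.sum_nonneg fun _ _ => abs_nonneg _
    · rw [zero_mul, add_zero]
      exact Finset.sum_congr rfl fun n _ => (vCharged_bigLam P R H n _ 0 (s n) rfl).symm
  · rintro z ⟨lam, _, rfl⟩
    rw [zero_mul, add_zero]
    exact Finset.sum_le_sum fun n _ => wPass_le P hP0 R H n lam _ 0 (s n) rfl
end

section
/- At full budget the RMAB value function decouples into a sum of unconstrained single-arm values: for every time t ≤ H and every joint state s, V t s N = ∑_n v n t (s n) 0̄. (Established in the proof of Theorem 3.) -/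
open Finset

theorem marg_aux {N : ℕ} {S : Type} [Fintype S] (q : Fin N → S → ℝ)
    (hq : ∀ n, ∑ x, q n x = 1) (m : Fin N) (f : S → ℝ) :
    ∑ s' : Fin N → S, (∏ n, q n (s' n)) * f (s' m) = ∑ x, q m x * f x := by
  have h := Finset.prod_univ_sum (fun _ : Fin N => (Finset.univ : Finset S))
    (fun n x => q n x * (if n = m then f x else 1))
  rw [Fintype.piFinset_univ] at h
  have h1 : ∀ s' : Fin N → S, (∏ n, q n (s' n)) * f (s' m) =
      ∏ n, (q n (s' n) * (if n = m then f (s' n) else 1)) := by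
    intro s'
    rw [Finset.prod_mul_distrib, Finset.prod_ite_eq' Finset.univ m (fun n => f (s' n))]
    simp
  rw [Finset.sum_congr rfl (fun s' _ => h1 s'), ← h, Finset.prod_eq_single m]
  · simp
  · intro b _ hb
    simp [hb, hq]
  · simp

theorem V_decouples_at_full_budget
    (N : ℕ) (S : Type) [Fintype S] [Nonempty S]
    (P : Fin N → S → Bool → S → ℝ)
    (hP0 : ∀ (n : Fin N) (x : S) (a : Bool) (x' : S), 0 ≤ P n x a x')
    (hP1 : ∀ (n : Fin N) (x : S) (a : Bool), ∑ x' : S, P n x a x' = 1)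
    (R : S → ℝ) (H : ℕ)
    (t : ℕ) (ht : t ≤ H) (s : Fin N → S) :
    Vval N P R H t s N = ∑ n : Fin N, vCharged N P R H n 0 t (s n) := by
  obtain ⟨k, hk⟩ : ∃ k, H = t + k := ⟨H - t, by omega⟩
  induction k generalizing t s with
  | zero =>
    have hn : ¬ t < H := by omega
    rw [Vval, dif_neg hn]
    symm
    apply Finset.sum_eq_zero
    intro n _
    rw [vCharged, dif_neg hn]
  | succ k ih =>
    have hlt : t < H := by omega
    have ih' := fun s' => ih (t + 1) (by omega) s' (by omega)
    have key : ∀ a : Fin N → Bool, (∑ n : Fin N, R (s n)) +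
        ∑ s' : Fin N → S, (∏ n : Fin N, P n (s n) (a n) (s' n)) * Vval N P R H (t+1) s' N
        = ∑ n : Fin N, (R (s n) +
            ∑ x : S, P n (s n) (a n) x * vCharged N P R H n 0 (t+1) x) := by
      intro a
      rw [Finset.sum_add_distrib]
      congr 1
      simp_rw [ih', Finset.mul_sum]
      rw [Finset.sum_comm]
      apply Finset.sum_congr rfl
      intro m _
      exact marg_aux (fun n x => P n (s n) (a n) x) (fun n => hP1 n _ _) m _
    have hv : ∀ n, vCharged N P R H n 0 t (s n) =
        max (R (s n) + ∑ x : S, P n (s n) false x * vCharged N P R H n 0 (t+1) x)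
          (R (s n) + ∑ x : S, P n (s n) true x * vCharged N P R H n 0 (t+1) x) := by
      intro n
      rw [vCharged, dif_pos hlt]
      simp
    rw [Vval, dif_pos hlt]
    apply le_antisymm
    · apply Finset.sup'_le
      intro a _
      rw [key]
      apply Finset.sum_le_sum
      intro n _
      rw [hv]
      cases a n
      · exact le_max_left _ _
      · exact le_max_right _ _
    · have hex : ∀ n, ∃ b : Bool, vCharged N P R H n 0 t (s n) =
          R (s n) + ∑ x : S, P n (s n) b x * vCharged N P R H n 0 (t+1) x := by
        intro n
        rw [hv]
        rcases max_choice
          (R (s n) + ∑ x : S, P n (s n) false x * vCharged N P R H n 0 (t+1) x)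
          (R (s n) + ∑ x : S, P n (s n) true x * vCharged N P R H n 0 (t+1) x) with h | h
        · exact ⟨false, h⟩
        · exact ⟨true, h⟩
      choose a ha using hex
      rw [Finset.sum_congr rfl (fun n _ => ha n), ← key a]
      apply Finset.le_sup' (fun a : Fin N → Bool => (∑ n : Fin N, R (s n)) +
        ∑ s' : Fin N → S, (∏ n : Fin N, P n (s n) (a n) (s' n)) * Vval N P R H (t+1) s' N)
      simp only [Finset.mem_filter, Finset.mem_univ, true_and]
      exact (Finset.card_le_univ _).trans (by simp)
end

section
/- Intermediate gap bound in the proof of Theorem 3: suppose N ≥ 1, all arms share the same transition kernel (P n = P 0 for all n), and the joint state satisfies s n = s₀ for all n. Then for every budget b ≤ N, L s (b : ℝ) − V 0 s b ≤ (N − b) * ( v 0 0 s₀ 0̄ − v̲ 0 0 s₀ ), where v 0 0 s₀ 0̄ is the unconstrained single-arm value and v̲ 0 0 s₀ the passive single-arm value of an arm started at s₀. -/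
open Finset

noncomputable def vPassive (N : ℕ) {S : Type} [Fintype S]
    (P : Fin N → S → Bool → S → ℝ) (R : S → ℝ) (H : ℕ)
    (n : Fin N) (t : ℕ) (x : S) : ℝ :=
  if t < H then R x + ∑ s' : S, P n x false s' * vPassive N P R H n (t+1) s' else 0
termination_by H - t
decreasing_by all_goals omega

theorem aux_marg {N : ℕ} {S : Type} [Fintype S] (p : Fin N → S → ℝ)
    (hp : ∀ n, ∑ x, p n x = 1) (f : S → ℝ) (m : Fin N) :
    ∑ s' : Fin N → S, (∏ n, p n (s' n)) * f (s' m) = ∑ x, p m x * f x := by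
  classical
  have h := Finset.prod_univ_sum (fun _ : Fin N => (Finset.univ : Finset S))
    (fun n x => p n x * (if n = m then f x else 1))
  rw [Fintype.piFinset_univ] at h
  have h1 : ∀ s' : Fin N → S, ∏ n, (p n (s' n) * (if n = m then f (s' n) else 1))
      = (∏ n, p n (s' n)) * f (s' m) := by
    intro s'
    rw [Finset.prod_mul_distrib, Finset.prod_ite_eq' Finset.univ m (fun n => f (s' n))]
    simp
  simp_rw [h1] at h
  rw [← h, Finset.prod_eq_single m]
  · simp
  · intro n _ hn
    simp [hn, hp]
  · simp

theorem aux_marg_sum {N : ℕ} {S : Type} [Fintype S] (p : Fin N → S → ℝ)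
    (hp : ∀ n, ∑ x, p n x = 1) (f : Fin N → S → ℝ) :
    ∑ s' : Fin N → S, (∏ n, p n (s' n)) * ∑ m, f m (s' m) = ∑ m, ∑ x, p m x * f m x := by
  simp_rw [Finset.mul_sum]
  rw [Finset.sum_comm]
  exact Finset.sum_congr rfl fun m _ => aux_marg p hp (f m) m

theorem aux_passive_le {N : ℕ} {S : Type} [Fintype S]
    (P : Fin N → S → Bool → S → ℝ)
    (hP0 : ∀ (n : Fin N) (x : S) (a : Bool) (x' : S), 0 ≤ P n x a x')
    (R : S → ℝ) (H : ℕ) (n : Fin N) (lam : Fin H → ℝ) (k : ℕ) :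
    ∀ (t : ℕ), H - t = k → ∀ x, vPassive N P R H n t x ≤ vCharged N P R H n lam t x := by
  induction k with
  | zero =>
    intro t ht x
    have : ¬ t < H := by omega
    rw [vPassive, vCharged]
    simp [this]
  | succ k ih =>
    intro t ht x
    have h : t < H := by omega
    rw [vPassive, vCharged, if_pos h, dif_pos h]
    refine le_trans ?_ (le_max_left _ _)
    gcongr with s' _
    · exact hP0 _ _ _ _
    · exact ih (t+1) (by omega) s'

theorem aux_charged_congr {N : ℕ} {S : Type} [Fintype S]
    (P : Fin N → S → Bool → S → ℝ) (R : S → ℝ) (H : ℕ) (n m : Fin N) (hnm : P n = P m)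
    (lam : Fin H → ℝ) (k : ℕ) :
    ∀ (t : ℕ), H - t = k → ∀ x, vCharged N P R H n lam t x = vCharged N P R H m lam t x ∧
      vPassive N P R H n t x = vPassive N P R H m t x := by
  induction k with
  | zero =>
    intro t ht x
    have : ¬ t < H := by omega
    rw [vPassive, vCharged, vPassive, vCharged]
    simp [this]
  | succ k ih =>
    intro t ht x
    have h : t < H := by omega
    rw [vPassive, vCharged, vPassive, vCharged, hnm]
    simp only [ih (t+1) (by omega), and_self]

theorem aux_V {N : ℕ} {S : Type} [Fintype S]
    (P : Fin N → S → Bool → S → ℝ)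
    (hP0 : ∀ (n : Fin N) (x : S) (a : Bool) (x' : S), 0 ≤ P n x a x')
    (hP1 : ∀ (n : Fin N) (x : S) (a : Bool), ∑ x' : S, P n x a x' = 1)
    (R : S → ℝ) (H : ℕ) (b : ℕ) (A : Finset (Fin N)) (hA : A.card ≤ b) (k : ℕ) :
    ∀ (t : ℕ), H - t = k → ∀ s : Fin N → S,
      ∑ n, (if n ∈ A then vCharged N P R H n 0 t (s n) else vPassive N P R H n t (s n))
        ≤ Vval N P R H t s b := by
  induction k with
  | zero =>
    intro t ht s
    have : ¬ t < H := by omega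
    rw [Vval, dif_neg this]
    apply le_of_eq
    apply Finset.sum_eq_zero
    intro n _
    rw [vPassive, vCharged]
    simp [this]
  | succ k ih =>
    intro t ht s
    have h : t < H := by omega
    let a : Fin N → Bool := fun n => decide (n ∈ A ∧
      ∑ s', P n (s n) false s' * vCharged N P R H n 0 (t+1) s' ≤
      ∑ s', P n (s n) true s' * vCharged N P R H n 0 (t+1) s')
    have ha : a ∈ (Finset.univ.filter (fun a : Fin N → Bool =>
        (Finset.univ.filter (fun n => a n = true)).card ≤ b)) := by
      simp only [Finset.mem_filter, Finset.mem_univ, true_and]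
      refine le_trans (Finset.card_le_card ?_) hA
      intro n hn
      simp only [a, Finset.mem_filter, decide_eq_true_eq] at hn
      exact hn.2.1
    rw [Vval, dif_pos h]
    refine le_trans ?_ (Finset.le_sup' _ ha)
    let f : Fin N → S → ℝ := fun n x =>
      if n ∈ A then vCharged N P R H n 0 (t+1) x else vPassive N P R H n (t+1) x
    have h2 : ∑ s' : Fin N → S, (∏ n, P n (s n) (a n) (s' n)) * ∑ m, f m (s' m)
        ≤ ∑ s' : Fin N → S, (∏ n, P n (s n) (a n) (s' n)) * Vval N P R H (t+1) s' b := by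
      refine Finset.sum_le_sum fun s' _ => mul_le_mul_of_nonneg_left (ih (t+1) (by omega) s') ?_
      exact Finset.prod_nonneg fun n _ => hP0 _ _ _ _
    rw [aux_marg_sum (fun n x => P n (s n) (a n) x) (fun n => hP1 _ _ _) f] at h2
    refine le_trans ?_ (add_le_add le_rfl h2)
    rw [← Finset.sum_add_distrib]
    refine Finset.sum_le_sum fun n _ => ?_
    rw [vCharged, vPassive, dif_pos h, if_pos h]
    by_cases hn : n ∈ A
    · simp only [hn, f, if_true, Pi.zero_apply, sub_zero]
      by_cases hc : ∑ s', P n (s n) false s' * vCharged N P R H n 0 (t+1) s' ≤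
        ∑ s', P n (s n) true s' * vCharged N P R H n 0 (t+1) s'
      · have : a n = true := by simp [a, hn, hc]
        rw [this]
        exact max_le (by linarith) le_rfl
      · have : a n = false := by simp [a, hn]; exact not_le.mp hc
        rw [this]
        exact max_le le_rfl (by linarith)
    · have : a n = false := by simp [a, hn]
      simp only [hn, f, if_false, this]
      exact le_rfl

theorem gap_bound_intermediate
    (N : ℕ) (hN : 1 ≤ N) (S : Type) [Fintype S] [Nonempty S]
    (P : Fin N → S → Bool → S → ℝ)
    (hP0 : ∀ (n : Fin N) (x : S) (a : Bool) (x' : S), 0 ≤ P n x a x')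
    (hP1 : ∀ (n : Fin N) (x : S) (a : Bool), ∑ x' : S, P n x a x' = 1)
    (R : S → ℝ) (H : ℕ)
    (hhom : ∀ n : Fin N, P n = P ⟨0, hN⟩)
    (s : Fin N → S) (s₀ : S) (hs : ∀ n : Fin N, s n = s₀)
    (b : ℕ) (hb : b ≤ N) :
    Lag N P R H s (b : ℝ) - Vval N P R H 0 s b ≤
      ((N : ℝ) - (b : ℝ)) *
        (vCharged N P R H ⟨0, hN⟩ 0 0 s₀ - vPassive N P R H ⟨0, hN⟩ 0 s₀) := by
  have hL : Lag N P R H s (b : ℝ) ≤ N * vCharged N P R H ⟨0, hN⟩ 0 0 s₀ := by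
    apply csInf_le
    · refine ⟨∑ n, vPassive N P R H n 0 (s n), ?_⟩
      rintro z ⟨lam, hl, rfl⟩
      have h1 : ∑ n, vPassive N P R H n 0 (s n) ≤ ∑ n, vCharged N P R H n lam 0 (s n) :=
        Finset.sum_le_sum fun n _ => aux_passive_le P hP0 R H n lam _ 0 rfl _
      have h2 : 0 ≤ (b : ℝ) * ∑ k : Fin H, lam k :=
        mul_nonneg (Nat.cast_nonneg _) (Finset.sum_nonneg fun k _ => hl k)
      linarith
    · refine ⟨0, fun _ => le_rfl, ?_⟩
      have : ∀ n, vCharged N P R H n 0 0 (s n) = vCharged N P R H ⟨0, hN⟩ 0 0 s₀ := fun n => by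
        rw [hs n]; exact (aux_charged_congr P R H n ⟨0, hN⟩ (hhom n) 0 _ 0 rfl s₀).1
      simp [this]
  obtain ⟨A, -, hA⟩ := Finset.exists_subset_card_eq
    (show b ≤ (Finset.univ : Finset (Fin N)).card by simpa using hb)
  have hV := aux_V P hP0 hP1 R H b A hA.le _ 0 rfl s
  have hE : ∀ n, (if n ∈ A then vCharged N P R H n 0 0 (s n) else vPassive N P R H n 0 (s n))
      = vPassive N P R H ⟨0, hN⟩ 0 s₀ + (if n ∈ A then
        vCharged N P R H ⟨0, hN⟩ 0 0 s₀ - vPassive N P R H ⟨0, hN⟩ 0 s₀ else 0) := fun n => by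
    obtain ⟨h1, h2⟩ := aux_charged_congr P R H n ⟨0, hN⟩ (hhom n) 0 _ 0 rfl s₀
    rw [hs n, h1, h2]
    split_ifs <;> ring
  simp only [hE, Finset.sum_add_distrib, Finset.sum_ite_mem, Finset.univ_inter,
    Finset.sum_const, hA, Finset.card_univ, Fintype.card_fin, nsmul_eq_mul] at hV
  linarith
end

section
/- Theorem 3 of the paper: suppose N ≥ 1, all arms share the same transition kernel (P n = P 0 for all n), the joint state satisfies s n = s₀ for all n, and rewards are normalized, i.e., 0 ≤ R x ≤ 1 for every state x : S. Then for every budget b ≤ N, the gap between the Lagrangian bound and the value function satisfies L s (b : ℝ) − V 0 s b ≤ (N − b) * H. -/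
open Finset

lemma prod_marginal {N : ℕ} {S : Type} [Fintype S] (p : Fin N → S → ℝ)
    (hp : ∀ n, ∑ x, p n x = 1) (m : Fin N) (f : S → ℝ) :
    ∑ s' : Fin N → S, (∏ n, p n (s' n)) * f (s' m) = ∑ x, p m x * f x := by
  classical
  have h := Finset.prod_univ_sum (fun _ : Fin N => (Finset.univ : Finset S))
    (fun n x => p n x * if n = m then f x else 1)
  rw [Fintype.piFinset_univ] at h
  have h1 : ∀ s' : Fin N → S, (∏ n, p n (s' n)) * f (s' m)
      = ∏ n, (p n (s' n) * if n = m then f (s' n) else 1) := by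
    intro s'
    rw [Finset.prod_mul_distrib]
    simp
  simp_rw [h1]
  rw [← h, Finset.prod_eq_single m]
  · simp
  · intro n _ hn
    simp [hn, hp]
  · simp

lemma vC_nonneg {N : ℕ} {S : Type} [Fintype S]
    (P : Fin N → S → Bool → S → ℝ)
    (hP0 : ∀ (n : Fin N) (x : S) (a : Bool) (x' : S), 0 ≤ P n x a x')
    (R : S → ℝ) (H : ℕ) (hR : ∀ x : S, 0 ≤ R x ∧ R x ≤ 1) (n : Fin N) (lam : Fin H → ℝ) :
    ∀ (k t : ℕ), H - t = k → ∀ x, 0 ≤ vCharged N P R H n lam t x := by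
  intro k
  induction k with
  | zero =>
    intro t ht x
    rw [vCharged, dif_neg (by omega)]
  | succ k ih =>
    intro t ht x
    rw [vCharged, dif_pos (by omega)]
    refine le_max_of_le_left (add_nonneg (hR x).1 (Finset.sum_nonneg fun y _ => ?_))
    exact mul_nonneg (hP0 _ _ _ _) (ih (t+1) (by omega) y)

lemma vC_le {N : ℕ} {S : Type} [Fintype S]
    (P : Fin N → S → Bool → S → ℝ)
    (hP0 : ∀ (n : Fin N) (x : S) (a : Bool) (x' : S), 0 ≤ P n x a x')
    (hP1 : ∀ (n : Fin N) (x : S) (a : Bool), ∑ x' : S, P n x a x' = 1)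
    (R : S → ℝ) (H : ℕ) (hR : ∀ x : S, 0 ≤ R x ∧ R x ≤ 1) (n : Fin N) :
    ∀ (k t : ℕ), H - t = k → ∀ x, vCharged N P R H n (fun _ => 0) t x ≤ k := by
  intro k
  induction k with
  | zero =>
    intro t ht x
    rw [vCharged, dif_neg (by omega)]
    simp
  | succ k ih =>
    intro t ht x
    rw [vCharged, dif_pos (by omega)]
    have key : ∀ a, ∑ y, P n x a y * vCharged N P R H n (fun _ => 0) (t+1) y ≤ k := by
      intro a
      calc _ ≤ ∑ y, P n x a y * (k : ℝ) := Finset.sum_le_sum fun y _ =>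
              mul_le_mul_of_nonneg_left (ih (t+1) (by omega) y) (hP0 _ _ _ _)
        _ = k := by rw [← Finset.sum_mul, hP1, one_mul]
    have := (hR x).2
    push_cast
    refine max_le ?_ ?_
    · linarith [key false]
    · linarith [key true]

lemma V_ge {N : ℕ} {S : Type} [Fintype S]
    (P : Fin N → S → Bool → S → ℝ)
    (hP0 : ∀ (n : Fin N) (x : S) (a : Bool) (x' : S), 0 ≤ P n x a x')
    (hP1 : ∀ (n : Fin N) (x : S) (a : Bool), ∑ x' : S, P n x a x' = 1)
    (R : S → ℝ) (H : ℕ) (hR : ∀ x : S, 0 ≤ R x ∧ R x ≤ 1) (b : ℕ)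
    (B : Finset (Fin N)) (hB : B.card ≤ b) :
    ∀ (k t : ℕ), H - t = k → ∀ s : Fin N → S,
      ∑ n ∈ B, vCharged N P R H n (fun _ => 0) t (s n) ≤ Vval N P R H t s b := by
  intro k
  induction k with
  | zero =>
    intro t ht s
    rw [Vval, dif_neg (by omega)]
    refine le_of_eq (Finset.sum_eq_zero fun n _ => ?_)
    rw [vCharged, dif_neg (by omega)]
  | succ k ih =>
    intro t ht s
    have htH : t < H := by omega
    have hopt : ∀ n, ∃ a : Bool, vCharged N P R H n (fun _ => 0) t (s n)
        = R (s n) + ∑ y, P n (s n) a y * vCharged N P R H n (fun _ => 0) (t+1) y := by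
      intro n
      rw [vCharged, dif_pos htH]
      rcases max_choice (R (s n) + ∑ y, P n (s n) false y * vCharged N P R H n (fun _ => 0) (t+1) y)
        ((R (s n) - 0) + ∑ y, P n (s n) true y * vCharged N P R H n (fun _ => 0) (t+1) y) with h | h
      · exact ⟨false, h⟩
      · exact ⟨true, by rw [h, sub_zero]⟩
    choose α hα using hopt
    let a : Fin N → Bool := fun n => if n ∈ B then α n else false
    have ha : a ∈ Finset.univ.filter (fun a : Fin N → Bool =>
        (Finset.univ.filter (fun n => a n = true)).card ≤ b) := by
      simp only [Finset.mem_filter, Finset.mem_univ, true_and]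
      refine (Finset.card_le_card ?_).trans hB
      intro n hn
      by_contra hc
      simp [a, hc] at hn
    rw [Vval, dif_pos htH]
    refine le_trans ?_ (Finset.le_sup' _ ha)
    have h1 : ∑ n ∈ B, R (s n) ≤ ∑ n, R (s n) :=
      Finset.sum_le_sum_of_subset_of_nonneg (Finset.subset_univ _) fun n _ _ => (hR _).1
    have h2 : ∑ n ∈ B, ∑ y, P n (s n) (α n) y * vCharged N P R H n (fun _ => 0) (t+1) y
        ≤ ∑ s' : Fin N → S, (∏ n : Fin N, P n (s n) (a n) (s' n)) * Vval N P R H (t+1) s' b := by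
      calc _ = ∑ n ∈ B, ∑ s' : Fin N → S, (∏ m : Fin N, P m (s m) (a m) (s' m)) *
              vCharged N P R H n (fun _ => 0) (t+1) (s' n) := by
            refine Finset.sum_congr rfl fun n hn => ?_
            rw [prod_marginal (fun m => P m (s m) (a m)) (fun m => hP1 _ _ _) n]
            simp [a, hn]
        _ = ∑ s' : Fin N → S, (∏ m : Fin N, P m (s m) (a m) (s' m)) *
              ∑ n ∈ B, vCharged N P R H n (fun _ => 0) (t+1) (s' n) := by
            rw [Finset.sum_comm]
            simp_rw [Finset.mul_sum]
        _ ≤ _ := Finset.sum_le_sum fun s' _ =>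
            mul_le_mul_of_nonneg_left (ih (t+1) (by omega) s')
              (Finset.prod_nonneg fun m _ => hP0 _ _ _ _)
    rw [Finset.sum_congr rfl fun n _ => hα n, Finset.sum_add_distrib]
    exact add_le_add h1 h2

theorem lagrangian_gap_bound
    (N : ℕ) (hN : 1 ≤ N) (S : Type) [Fintype S] [Nonempty S]
    (P : Fin N → S → Bool → S → ℝ)
    (hP0 : ∀ (n : Fin N) (x : S) (a : Bool) (x' : S), 0 ≤ P n x a x')
    (hP1 : ∀ (n : Fin N) (x : S) (a : Bool), ∑ x' : S, P n x a x' = 1)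
    (R : S → ℝ) (H : ℕ)
    (hR : ∀ x : S, 0 ≤ R x ∧ R x ≤ 1)
    (hhom : ∀ n : Fin N, P n = P ⟨0, hN⟩)
    (s : Fin N → S) (s₀ : S) (hs : ∀ n : Fin N, s n = s₀)
    (b : ℕ) (hb : b ≤ N) :
    Lag N P R H s (b : ℝ) - Vval N P R H 0 s b ≤ ((N : ℝ) - (b : ℝ)) * (H : ℝ) := by
  obtain ⟨B, hB⟩ : ∃ B : Finset (Fin N), B.card = b := by
    obtain ⟨B, _, hB⟩ := Finset.exists_subset_card_eq
      (show b ≤ (Finset.univ : Finset (Fin N)).card by simpa using hb)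
    exact ⟨B, hB⟩
  have hV := V_ge P hP0 hP1 R H hR b B hB.le H 0 rfl s
  have hL : Lag N P R H s (b : ℝ) ≤ ∑ n, vCharged N P R H n (fun _ => 0) 0 (s n) := by
    refine csInf_le ⟨0, ?_⟩ ⟨fun _ => 0, fun _ => le_rfl, by simp⟩
    rintro z ⟨lam, hlam, rfl⟩
    exact add_nonneg (Finset.sum_nonneg fun n _ => vC_nonneg P hP0 R H hR n lam H 0 rfl _)
      (mul_nonneg (Nat.cast_nonneg _) (Finset.sum_nonneg fun k _ => hlam k))
  have hsplit := Finset.sum_add_sum_compl B (fun n => vCharged N P R H n (fun _ => 0) 0 (s n))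
  have hc : ∑ n ∈ Bᶜ, vCharged N P R H n (fun _ => 0) 0 (s n) ≤ ((N : ℝ) - b) * H := by
    refine (Finset.sum_le_card_nsmul _ _ (H : ℝ)
      fun n _ => vC_le P hP0 hP1 R H hR n H 0 rfl (s n)).trans (le_of_eq ?_)
    rw [Finset.card_compl, Fintype.card_fin, hB, nsmul_eq_mul, Nat.cast_sub hb]
  linarith
end

section
/- Upper bound of Theorem 4: assume N ≥ 1. Then for every joint state s and every budget b : ℕ, the group value is at most the group size times the best single-arm value: V 0 s b ≤ N * max over arms a : Fin N of vᵃ 0 (s a) b. -/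
open Finset

noncomputable def vSingle (N : ℕ) {S : Type} [Fintype S]
    (P : Fin N → S → Bool → S → ℝ) (R : S → ℝ) (H : ℕ)
    (a : Fin N) (t : ℕ) (x : S) (b : ℕ) : ℝ :=
  Vval 1 (fun _ => P a) R H t (fun _ => x) b

theorem aux_marginal (N : ℕ) {S : Type} [Fintype S]
    (Q : Fin N → S → ℝ) (hQ : ∀ n, ∑ x, Q n x = 1) (n : Fin N) (f : S → ℝ) :
    ∑ s' : Fin N → S, (∏ m, Q m (s' m)) * f (s' n) = ∑ x, Q n x * f x := by
  classical
  have h1 : ∀ s' : Fin N → S, (∏ m, Q m (s' m)) * f (s' n)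
      = ∏ m, (Q m (s' m) * if m = n then f (s' m) else 1) := by
    intro s'
    rw [Finset.prod_mul_distrib]
    congr 1
    simp
  simp_rw [h1]
  rw [← Fintype.prod_sum (fun m x => Q m x * if m = n then f x else 1)]
  rw [Finset.prod_eq_single n]
  · simp
  · intro m _ hm
    simp [hm, hQ]
  · simp

theorem aux_single (N : ℕ) {S : Type} [Fintype S]
    (P : Fin N → S → Bool → S → ℝ) (R : S → ℝ) (H : ℕ) (n : Fin N) (t : ℕ) (ht : t < H)
    (x : S) (b : ℕ) (c : Bool) (hc : c = true → 1 ≤ b) :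
    R x + ∑ x', P n x c x' * vSingle N P R H n (t+1) x' b ≤ vSingle N P R H n t x b := by
  classical
  conv_rhs => rw [vSingle, Vval]
  rw [dif_pos ht]
  refine le_trans (le_of_eq ?_) (Finset.le_sup' _ (b := fun _ => c) ?_)
  · simp only [Fin.sum_univ_one, Fin.prod_univ_one]
    congr 1
    rw [← (Equiv.funUnique (Fin 1) S).symm.sum_comp]
    rfl
  · cases c <;> simp_all

theorem aux_main (N : ℕ) {S : Type} [Fintype S]
    (P : Fin N → S → Bool → S → ℝ)
    (hP0 : ∀ (n : Fin N) (x : S) (a : Bool) (x' : S), 0 ≤ P n x a x')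
    (hP1 : ∀ (n : Fin N) (x : S) (a : Bool), ∑ x' : S, P n x a x' = 1)
    (R : S → ℝ) (H : ℕ) (b : ℕ) (k : ℕ) : ∀ (t : ℕ), H - t = k → ∀ (s : Fin N → S),
    Vval N P R H t s b ≤ ∑ n, vSingle N P R H n t (s n) b := by
  classical
  induction k with
  | zero =>
    intro t ht s
    have h : ¬ t < H := by omega
    have h0 : ∀ n, vSingle N P R H n t (s n) b = 0 := by
      intro n
      rw [vSingle, Vval, dif_neg h]
    rw [Vval, dif_neg h]
    simp [h0]
  | succ k ih =>
    intro t ht s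
    have h : t < H := by omega
    rw [Vval, dif_pos h]
    apply Finset.sup'_le
    intro a ha
    have ha' := (Finset.mem_filter.mp ha).2
    calc _ ≤ (∑ n : Fin N, R (s n)) + ∑ s' : Fin N → S, (∏ n : Fin N, P n (s n) (a n) (s' n))
            * ∑ n, vSingle N P R H n (t+1) (s' n) b := by
          gcongr with s' _
          · exact Finset.prod_nonneg fun n _ => hP0 _ _ _ _
          · exact ih (t+1) (by omega) s'
      _ = ∑ n, (R (s n) + ∑ x', P n (s n) (a n) x' * vSingle N P R H n (t+1) x' b) := by
          rw [Finset.sum_add_distrib]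
          congr 1
          simp_rw [Finset.mul_sum]
          rw [Finset.sum_comm]
          refine Finset.sum_congr rfl fun n _ => ?_
          exact aux_marginal N (fun m x => P m (s m) (a m) x) (fun m => hP1 _ _ _) n
            (fun x => vSingle N P R H n (t+1) x b)
      _ ≤ _ := by
          refine Finset.sum_le_sum fun n _ => ?_
          refine aux_single N P R H n t h _ b _ fun hc => ?_
          refine le_trans (Finset.card_pos.mpr ⟨n, ?_⟩) ha'
          simp [hc]

theorem group_value_le_size_mul_best_arm
    (N : ℕ) (hN : 1 ≤ N) (S : Type) [Fintype S] [Nonempty S]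
    (P : Fin N → S → Bool → S → ℝ)
    (hP0 : ∀ (n : Fin N) (x : S) (a : Bool) (x' : S), 0 ≤ P n x a x')
    (hP1 : ∀ (n : Fin N) (x : S) (a : Bool), ∑ x' : S, P n x a x' = 1)
    (R : S → ℝ) (H : ℕ)
    (s : Fin N → S) (b : ℕ) :
    Vval N P R H 0 s b ≤
      (N : ℝ) * Finset.univ.sup' ⟨⟨0, hN⟩, Finset.mem_univ _⟩
        (fun a : Fin N => vSingle N P R H a 0 (s a) b) := by
  refine le_trans (aux_main N P hP0 hP1 R H b _ 0 rfl s) ?_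
  have hb : ∀ n ∈ (Finset.univ : Finset (Fin N)), vSingle N P R H n 0 (s n) b ≤
      Finset.univ.sup' ⟨⟨0, hN⟩, Finset.mem_univ _⟩
        (fun a : Fin N => vSingle N P R H a 0 (s a) b) := fun n hn =>
    Finset.le_sup' (fun a : Fin N => vSingle N P R H a 0 (s a) b) hn
  have h2 := Finset.sum_le_card_nsmul _ _ _ hb
  rw [Finset.card_univ, Fintype.card_fin, nsmul_eq_mul] at h2
  exact h2
end

section
/- Fully decoupled upper bound (Eq. 14 in the proof of Theorem 4): for every joint state s and every budget b : ℕ, the group value is at most the sum of the single-arm values in which every arm may be acted on every round: V 0 s b ≤ ∑ over arms a : Fin N of vᵃ 0 (s a) 1. -/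
open Finset

theorem marginal_sum (N : ℕ) {S : Type} [Fintype S] (p : Fin N → S → ℝ)
    (h1 : ∀ n, ∑ x, p n x = 1) (m : Fin N) (f : S → ℝ) :
    ∑ s' : Fin N → S, (∏ n, p n (s' n)) * f (s' m) = ∑ x, p m x * f x := by
  have h := Finset.prod_univ_sum (fun _ : Fin N => (Finset.univ : Finset S))
    (fun n x => p n x * (if n = m then f x else 1))
  rw [Fintype.piFinset_univ] at h
  have hl : ∏ n : Fin N, ∑ x : S, p n x * (if n = m then f x else 1) = ∑ x, p m x * f x := by
    rw [Finset.prod_eq_single m]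
    · simp
    · intro n _ hn
      simp [hn, h1]
    · simp
  rw [hl] at h
  rw [h]
  refine Finset.sum_congr rfl fun s' _ => ?_
  rw [Finset.prod_mul_distrib]
  simp

theorem vSingle_ge (N : ℕ) {S : Type} [Fintype S]
    (P : Fin N → S → Bool → S → ℝ) (R : S → ℝ) (H : ℕ)
    (a : Fin N) (t : ℕ) (ht : t < H) (x : S) (c : Bool) :
    R x + ∑ x', P a x c x' * vSingle N P R H a (t+1) x' 1 ≤ vSingle N P R H a t x 1 := by
  have e : vSingle N P R H a t x 1 = Vval 1 (fun _ => P a) R H t (fun _ => x) 1 := rfl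
  rw [e, Vval, dif_pos ht]
  refine le_trans (le_of_eq ?_) (Finset.le_sup' _ (b := fun _ => c) ?_)
  · rw [← (Equiv.funUnique (Fin 1) S).symm.sum_comp]
    simp [vSingle]
    rfl
  · simp only [Finset.mem_filter, Finset.mem_univ, true_and]
    exact (Finset.card_le_univ _).trans (by simp)

theorem group_le_aux (N : ℕ) {S : Type} [Fintype S]
    (P : Fin N → S → Bool → S → ℝ)
    (hP0 : ∀ (n : Fin N) (x : S) (a : Bool) (x' : S), 0 ≤ P n x a x')
    (hP1 : ∀ (n : Fin N) (x : S) (a : Bool), ∑ x' : S, P n x a x' = 1)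
    (R : S → ℝ) (H : ℕ) (b : ℕ) (k : ℕ) : ∀ (t : ℕ) (_ : H - t = k) (s : Fin N → S),
    Vval N P R H t s b ≤ ∑ a : Fin N, vSingle N P R H a t (s a) 1 := by
  induction k with
  | zero =>
    intro t hk s
    have ht : ¬ t < H := by omega
    simp only [vSingle]
    rw [Vval, dif_neg ht]
    refine Finset.sum_nonneg fun a _ => ?_
    rw [Vval, dif_neg ht]
  | succ k ih =>
    intro t hk s
    have ht : t < H := by omega
    rw [Vval, dif_pos ht]
    refine Finset.sup'_le _ _ fun c _ => ?_
    calc _ ≤ (∑ n : Fin N, R (s n)) + ∑ s' : Fin N → S, (∏ n : Fin N, P n (s n) (c n) (s' n)) *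
              ∑ a : Fin N, vSingle N P R H a (t+1) (s' a) 1 := by
            gcongr with s' _
            · exact Finset.prod_nonneg fun n _ => hP0 _ _ _ _
            · exact ih (t+1) (by omega) s'
      _ = ∑ a : Fin N, (R (s a) + ∑ x', P a (s a) (c a) x' * vSingle N P R H a (t+1) x' 1) := by
            rw [Finset.sum_add_distrib]
            congr 1
            simp_rw [Finset.mul_sum]
            rw [Finset.sum_comm]
            refine Finset.sum_congr rfl fun a _ => ?_
            exact marginal_sum N (fun n => P n (s n) (c n)) (fun n => hP1 _ _ _) a
              (fun x => vSingle N P R H a (t+1) x 1)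
      _ ≤ _ := Finset.sum_le_sum fun a _ => vSingle_ge N P R H a t ht (s a) (c a)

theorem group_value_le_sum_of_always_act_arms
    (N : ℕ) (S : Type) [Fintype S] [Nonempty S]
    (P : Fin N → S → Bool → S → ℝ)
    (hP0 : ∀ (n : Fin N) (x : S) (a : Bool) (x' : S), 0 ≤ P n x a x')
    (hP1 : ∀ (n : Fin N) (x : S) (a : Bool), ∑ x' : S, P n x a x' = 1)
    (R : S → ℝ) (H : ℕ)
    (s : Fin N → S) (b : ℕ) :
    Vval N P R H 0 s b ≤ ∑ a : Fin N, vSingle N P R H a 0 (s a) 1 := by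
  exact group_le_aux N P hP0 hP1 R H b _ 0 rfl s
end

section
/- Optimality of the water-filling algorithm for the maximin objective (claimed in Section 'Solving MMR'): let G ≥ 1 and let f : Fin G → ℕ → ℝ be such that each f g is monotone nondecreasing. Let B : ℕ and let x : ℕ → (Fin G → ℕ) be any greedy water-filling run, i.e., x 0 = 0 and for each i < B there is a group gᵢ with f gᵢ (x i gᵢ) = min over g of f g (x i g), and x (i+1) equals x i with gᵢ's coordinate increased by 1. Then the resulting allocation is maximin-optimal: min over g of f g (x B g) = max over allocations y : Fin G → ℕ with ∑_g y g = B of (min over g of f g (y g)). -/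
open Finset

theorem water_filling_maximin_optimal
    (G : ℕ) (hG : 1 ≤ G) (f : Fin G → ℕ → ℝ) (hf : ∀ g : Fin G, Monotone (f g))
    (B : ℕ) (x : ℕ → Fin G → ℕ) (hx0 : x 0 = 0)
    (hstep : ∀ i < B, ∃ g : Fin G,
      f g (x i g) =
        Finset.univ.inf' ⟨⟨0, hG⟩, Finset.mem_univ _⟩ (fun g' : Fin G => f g' (x i g')) ∧
      x (i + 1) = Function.update (x i) g (x i g + 1)) :
    IsGreatest
      {r : ℝ | ∃ y : Fin G → ℕ, (∑ g : Fin G, y g) = B ∧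
        r = Finset.univ.inf' ⟨⟨0, hG⟩, Finset.mem_univ _⟩ (fun g : Fin G => f g (y g))}
      (Finset.univ.inf' ⟨⟨0, hG⟩, Finset.mem_univ _⟩ (fun g : Fin G => f g (x B g))) := by
  have hsum : ∀ i ≤ B, (∑ g : Fin G, x i g) = i := by
    intro i
    induction i with
    | zero => intro _; simp [hx0]
    | succ k ih =>
      intro hk
      obtain ⟨g, -, h2⟩ := hstep k (by omega)
      have h := ih (by omega)
      rw [h2, Finset.sum_update_of_mem (Finset.mem_univ g)]
      rw [← Finset.add_sum_erase _ _ (Finset.mem_univ g), Finset.erase_eq] at h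
      omega
  refine ⟨⟨x B, hsum B le_rfl, rfl⟩, ?_⟩
  rintro r ⟨y, hy, hr⟩
  have hry : ∀ g, r ≤ f g (y g) := by
    intro g
    rw [hr]
    exact Finset.inf'_le (fun g : Fin G => f g (y g)) (Finset.mem_univ g)
  have inv : ∀ i ≤ B, (∀ g, x i g ≤ y g) ∨ ∀ g, r ≤ f g (x i g) := by
    intro i
    induction i with
    | zero => intro _; left; simp [hx0]
    | succ k ih =>
      intro hk
      obtain ⟨g, h1, h2⟩ := hstep k (by omega)
      have key : (∀ g, r ≤ f g (x k g)) → ∀ g, r ≤ f g (x (k + 1) g) := by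
        intro h g'
        refine (h g').trans (hf g' ?_)
        rw [h2, Function.update_apply]
        split_ifs with e
        · subst e; omega
        · exact le_rfl
      rcases ih (by omega) with h | h
      · by_cases hlt : x k g < y g
        · left
          intro g'
          rw [h2, Function.update_apply]
          split_ifs with e
          · subst e; omega
          · exact h g'
        · right
          apply key
          intro g'
          have e : x k g = y g := le_antisymm (h g) (not_lt.mp hlt)
          calc r ≤ f g (x k g) := by rw [e]; exact hry g
            _ ≤ f g' (x k g') := by
              rw [h1]
              exact Finset.inf'_le (fun g : Fin G => f g (x k g)) (Finset.mem_univ g')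
      · exact Or.inr (key h)
  apply Finset.le_inf'
  intro g _
  rcases inv B le_rfl with h | h
  · have e := (Finset.sum_eq_sum_iff_of_le (fun i (_ : i ∈ Finset.univ) => h i)).mp
      ((hsum B le_rfl).trans hy.symm) g (Finset.mem_univ g)
    rw [e]
    exact hry g
  · exact h g
end

section
/- Convexity of the charged single-arm value function in the charge vector (used in the proof of Theorem 2): for every arm n, every time t ≤ H, and every state x : S, the map λ ↦ v n t x λ from (Fin H → ℝ) to ℝ is convex, i.e., for all charge vectors λ, λ' and every θ ∈ [0,1], v n t x (θ•λ + (1−θ)•λ') ≤ θ * (v n t x λ) + (1−θ) * (v n t x λ'). -/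
open Finset

theorem vCharged_convex_in_charge
    (N : ℕ) (S : Type) [Fintype S] [Nonempty S]
    (P : Fin N → S → Bool → S → ℝ)
    (hP0 : ∀ (n : Fin N) (x : S) (a : Bool) (x' : S), 0 ≤ P n x a x')
    (hP1 : ∀ (n : Fin N) (x : S) (a : Bool), ∑ x' : S, P n x a x' = 1)
    (R : S → ℝ) (H : ℕ)
    (n : Fin N) (t : ℕ) (ht : t ≤ H) (x : S)
    (lam lam' : Fin H → ℝ) (θ : ℝ) (hθ0 : 0 ≤ θ) (hθ1 : θ ≤ 1) :
    vCharged N P R H n (θ • lam + (1 - θ) • lam') t x ≤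
      θ * vCharged N P R H n lam t x + (1 - θ) * vCharged N P R H n lam' t x := by
  have key : ∀ a : Bool, ∀ t : ℕ, (∀ y : S,
      vCharged N P R H n (θ • lam + (1 - θ) • lam') (t+1) y ≤
        θ * vCharged N P R H n lam (t+1) y + (1 - θ) * vCharged N P R H n lam' (t+1) y) →
      ∀ x : S,
      ∑ y : S, P n x a y * vCharged N P R H n (θ • lam + (1 - θ) • lam') (t+1) y ≤
        θ * ∑ y : S, P n x a y * vCharged N P R H n lam (t+1) y +
        (1 - θ) * ∑ y : S, P n x a y * vCharged N P R H n lam' (t+1) y := by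
    intro a t ih x
    rw [Finset.mul_sum, Finset.mul_sum, ← Finset.sum_add_distrib]
    apply Finset.sum_le_sum
    intro y _
    have := mul_le_mul_of_nonneg_left (ih y) (hP0 n x a y)
    linarith
  induction ht using Nat.decreasingInduction generalizing x with
  | self =>
    have h0 : ∀ l : Fin H → ℝ, vCharged N P R H n l H x = 0 := by
      intro l
      rw [vCharged]
      simp
    simp [h0]
  | of_succ t ht ih =>
    have hu : ∀ l : Fin H → ℝ, vCharged N P R H n l t x =
        max (R x + ∑ s' : S, P n x false s' * vCharged N P R H n l (t+1) s')
          ((R x - l ⟨t, ht⟩) + ∑ s' : S, P n x true s' * vCharged N P R H n l (t+1) s') := by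
      intro l
      rw [vCharged, dif_pos ht]
    have kf := key false t ih x
    have kt := key true t ih x
    have h1 : 0 ≤ 1 - θ := by linarith
    rw [hu, hu lam, hu lam']
    apply max_le
    · refine le_trans ?_ (add_le_add (mul_le_mul_of_nonneg_left (le_max_left _ _) hθ0)
        (mul_le_mul_of_nonneg_left (le_max_left _ _) h1))
      linarith
    · refine le_trans ?_ (add_le_add (mul_le_mul_of_nonneg_left (le_max_right _ _) hθ0)
        (mul_le_mul_of_nonneg_left (le_max_right _ _) h1))
      simp only [Pi.add_apply, Pi.smul_apply, smul_eq_mul]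
      linarith
end
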